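/- arXiv:2410.16998 — 2 statements merged into one kernel-verified Lean document; each statement's English description precedes it below -/
import Mathlib

section
/- Let α₀, α₁, α₂, α₃ be real numbers with α₂ ≠ 0 and α₃ ≠ 0, and define the linear inverse demand function f(Q, Z, Y) = α₀ + (α₁ + α₂·Z)·Q + α₃·Y. Then for all Q > 0 and all Z, Y, the ratio of partial derivatives (∂f/∂Y)/(∂f/∂Z) equals α₃/(α₂·Q), and its partial derivative with respect to Q equals −α₃/(α₂·Q²), which is nonzero. Hence this demand function is not separable in (Z, Y). -/
/-- Bresnahan's linear inverse demand `f(Q, Z, Y) = α₀ + (α₁ + α₂·Z)·Q + α₃·Y` with a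
demand rotation instrument `Z` is not separable in `(Z, Y)`: for `Q > 0`, the ratio
`(∂f/∂Y)/(∂f/∂Z)` equals `α₃/(α₂·Q)`, and its partial derivative with respect to `Q`
equals `−α₃/(α₂·Q²)`, which is nonzero. -/
theorem linear_demand_not_separable
    (α₀ α₁ α₂ α₃ : ℝ) (hα₂ : α₂ ≠ 0) (hα₃ : α₃ ≠ 0)
    (f : ℝ → ℝ → ℝ → ℝ)
    (hf : ∀ Q Z Y : ℝ, f Q Z Y = α₀ + (α₁ + α₂ * Z) * Q + α₃ * Y) :
    ∀ Q Z Y : ℝ, 0 < Q →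
      deriv (fun y => f Q Z y) Y / deriv (fun z => f Q z Y) Z = α₃ / (α₂ * Q) ∧
      deriv (fun q =>
          deriv (fun y => f q Z y) Y / deriv (fun z => f q z Y) Z) Q
        = -α₃ / (α₂ * Q ^ 2) ∧
      -α₃ / (α₂ * Q ^ 2) ≠ 0 := by
  intro Q Z Y hQ
  have hY : ∀ q, deriv (fun y => f q Z y) Y = α₃ := fun q => by simp [hf]
  have hZ : ∀ q, deriv (fun z => f q z Y) Z = α₂ * q := fun q => by simp [hf]
  simp only [hY, hZ]
  have hQ' : Q ≠ 0 := hQ.ne'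
  refine ⟨trivial, ?_, div_ne_zero (neg_ne_zero.mpr hα₃) (mul_ne_zero hα₂ (pow_ne_zero 2 hQ'))⟩
  have h := ((hasDerivAt_const Q α₃).fun_div ((hasDerivAt_id' Q).const_mul α₂)
    (mul_ne_zero hα₂ hQ')).deriv
  rw [h]
  field_simp
  ring
end

section
/- Let α₀ ∈ (−1, 0), let θ, θ′ ∈ [0, 1], and let β₀, β₁, β₂, β₀′, β₁′, β₂′ be real numbers. Suppose that for all Q, X₁, X₂ > 0, −log(1 + θα₀) + β₀·log Q + β₁·log X₁ + β₂·log X₂ = −log(1 + θ′α₀) + β₀′·log Q + β₁′·log X₁ + β₂′·log X₂. Then θ = θ′, β₀ = β₀′, β₁ = β₁′, and β₂ = β₂′. -/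
/-- The intercept `-log (1 + θα)` determines the conduct parameter `θ ∈ [0,1]` when `α ∈ (-1,0)`. -/
theorem conduct_intercept_injOn {α : ℝ} (hα : α ∈ Set.Ioo (-1 : ℝ) 0) :
    Set.InjOn (fun θ : ℝ => -Real.log (1 + θ * α)) (Set.Icc 0 1) := by
  have hpos : ∀ t ∈ Set.Icc (0 : ℝ) 1, 0 < 1 + t * α := fun t ht => by
    nlinarith [hα.1, hα.2, ht.1, ht.2]
  intro θ hθ θ' hθ' h
  have h1 := Real.log_injOn_pos (hpos θ hθ) (hpos θ' hθ') (neg_injective h)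
  exact mul_right_cancel₀ hα.2.ne (add_left_cancel h1)

/-- Identification of the supply-side parameters: if two log-linear supply functions
with conduct parameters `θ, θ′ ∈ [0,1]` and cost parameters `(β₀,β₁,β₂)`, `(β₀′,β₁′,β₂′)`
coincide at all positive `Q, X₁, X₂`, then all the parameters coincide. -/
theorem supply_parameters_identified
    (α₀ : ℝ) (hα₀ : α₀ ∈ Set.Ioo (-1 : ℝ) 0)
    (θ θ' : ℝ) (hθ : θ ∈ Set.Icc (0 : ℝ) 1) (hθ' : θ' ∈ Set.Icc (0 : ℝ) 1)
    (β₀ β₁ β₂ β₀' β₁' β₂' : ℝ)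
    (heq : ∀ Q X₁ X₂ : ℝ, 0 < Q → 0 < X₁ → 0 < X₂ →
      -Real.log (1 + θ * α₀) + β₀ * Real.log Q + β₁ * Real.log X₁ + β₂ * Real.log X₂
        = -Real.log (1 + θ' * α₀) + β₀' * Real.log Q + β₁' * Real.log X₁
            + β₂' * Real.log X₂) :
    θ = θ' ∧ β₀ = β₀' ∧ β₁ = β₁' ∧ β₂ = β₂' := by
  have hconst := heq 1 1 1 one_pos one_pos one_pos
  have hQ := heq (Real.exp 1) 1 1 (Real.exp_pos 1) one_pos one_pos
  have hX₁ := heq 1 (Real.exp 1) 1 one_pos (Real.exp_pos 1) one_pos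
  have hX₂ := heq 1 1 (Real.exp 1) one_pos one_pos (Real.exp_pos 1)
  simp only [Real.log_exp, Real.log_one, mul_zero, mul_one, add_zero] at hconst hQ hX₁ hX₂
  exact ⟨conduct_intercept_injOn hα₀ hθ hθ' hconst, by linarith, by linarith, by linarith⟩
end
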